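/- Assume (A3). Let M, N be circles with p ∉ M and p ∉ N such that M ∖ p̄ and N ∖ p̄ are parallel lines of SA(p,K), neither of which is straight. Then (M ∖ p̄) ∩ (N ∖ p̄) = ∅ if and only if the base points of M and N are distinct and parallel. -/

import Mathlib

/-- A Laguerre plane: points, circles, and a parallelity relation. -/
structure LaguerrePlane (P : Type*) where
  Circles : Set (Set P)
  Par : P → P → Prop
  par_equiv : Equivalence Par
  joinCircle : ∀ a b c : P, ¬ Par a b → ¬ Par b c → ¬ Par a c →
    ∃! C, C ∈ Circles ∧ a ∈ C ∧ b ∈ C ∧ c ∈ C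
  touching : ∀ K ∈ Circles, ∀ p ∈ K, ∀ q, q ∉ K → ¬ Par p q →
    ∃! C, C ∈ Circles ∧ q ∈ C ∧ K ∩ C = {p}
  parPoint : ∀ (x : P), ∀ K ∈ Circles, ∃! q, Par x q ∧ q ∈ K
  nontriv : ∃ C ∈ Circles,
    (∃ a b c : P, a ∈ C ∧ b ∈ C ∧ c ∈ C ∧ a ≠ b ∧ b ≠ c ∧ a ≠ c) ∧ C ≠ Set.univ

namespace LaguerrePlane

variable {P : Type*}

/-- The generator (parallel class) of a point. -/
def gen (L : LaguerrePlane P) (p : P) : Set P := {q | L.Par p q}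

/-- The pencil ⟨p,K⟩: the circle K together with all circles tangent to K at p. -/
def pencil (L : LaguerrePlane P) (p : P) (K : Set P) : Set (Set P) :=
  insert K {M | M ∈ L.Circles ∧ M ∩ K = {p}}

/-- An automorphism of a Laguerre plane: a bijection of the points mapping
circles onto circles and preserving parallelity. -/
def IsAut (L : LaguerrePlane P) (σ : Equiv.Perm P) : Prop :=
  (∀ C, C ∈ L.Circles ↔ ⇑σ '' C ∈ L.Circles) ∧
  (∀ x y, L.Par x y ↔ L.Par (σ x) (σ y))

/-- The line x ⊔ y of the residual plane SA(p,K):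
{x} together with the orbit of y under the stabilizer of x in Δ. -/
def line (Δ : Subgroup (Equiv.Perm P)) (x y : P) : Set P :=
  {x} ∪ {z | ∃ σ ∈ Δ, σ x = x ∧ σ y = z}

/-- Parallelity of lines of the residual plane SA(p,K). -/
def LinePar (Δ : Subgroup (Equiv.Perm P)) (A B : Set P) : Prop :=
  ∃ σ ∈ Δ, ⇑σ '' A = B

end LaguerrePlane

open LaguerrePlane

namespace LaguerrePlane

variable {P : Type*} {L : LaguerrePlane P} {p : P} {K : Set P} {Δ : Subgroup (Equiv.Perm P)}

theorem eq_of_par {C : Set P} (hC : C ∈ L.Circles) {x y : P} (hx : x ∈ C) (hy : y ∈ C)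
    (h : L.Par x y) : x = y :=
  (L.parPoint x C hC).unique ⟨L.par_equiv.refl x, hx⟩ ⟨h, hy⟩

theorem circle_of_mem_pencil (hK : K ∈ L.Circles) {C : Set P} (hC : C ∈ L.pencil p K) :
    C ∈ L.Circles := by
  rcases hC with rfl | hC
  · exact hK
  · exact hC.1

theorem mem_of_mem_pencil (hpK : p ∈ K) {C : Set P} (hC : C ∈ L.pencil p K) : p ∈ C := by
  rcases hC with rfl | hC
  · exact hpK
  · have : p ∈ C ∩ K := by rw [hC.2]; rfl
    exact this.1

theorem exists_mem_pencil (hK : K ∈ L.Circles) (hpK : p ∈ K) {x : P} (hx : ¬ L.Par p x) :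
    ∃ C ∈ L.pencil p K, x ∈ C := by
  by_cases hxK : x ∈ K
  · exact ⟨K, Or.inl rfl, hxK⟩
  · obtain ⟨C, ⟨hC, hxC, hKC⟩, -⟩ := L.touching K hK p hpK x hxK hx
    exact ⟨C, Or.inr ⟨hC, by rw [Set.inter_comm, hKC]⟩, hxC⟩

theorem not_mem_of_inter_eq {C : Set P} (h : C ∩ K = {p}) {x : P} (hx : ¬ L.Par p x)
    (hxC : x ∈ C) : x ∉ K := fun hxK => by
  have : x ∈ C ∩ K := ⟨hxC, hxK⟩
  rw [h] at this
  exact hx (this ▸ L.par_equiv.refl x)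

theorem pencil_eq_of_mem (hK : K ∈ L.Circles) (hpK : p ∈ K) {C D : Set P}
    (hC : C ∈ L.pencil p K) (hD : D ∈ L.pencil p K) {x : P} (hx : ¬ L.Par p x)
    (hxC : x ∈ C) (hxD : x ∈ D) : C = D := by
  rcases hC with rfl | hC <;> rcases hD with rfl | hD
  · rfl
  · exact absurd hxC (not_mem_of_inter_eq hD.2 hx hxD)
  · exact absurd hxD (not_mem_of_inter_eq hC.2 hx hxC)
  · exact (L.touching K hK p hpK x (not_mem_of_inter_eq hC.2 hx hxC) hx).unique
      ⟨hC.1, hxC, by rw [Set.inter_comm, hC.2]⟩ ⟨hD.1, hxD, by rw [Set.inter_comm, hD.2]⟩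

/-- `b` is the point of tangency of `M` with a circle of the pencil ⟨p,K⟩. -/
def IsBase (L : LaguerrePlane P) (p : P) (K M : Set P) (b : P) : Prop :=
  ∃ C ∈ L.pencil p K, M ∩ C = {b}

theorem IsBase.mem {M : Set P} {b : P} (h : L.IsBase p K M b) : b ∈ M := by
  obtain ⟨C, -, h⟩ := h
  have : b ∈ M ∩ C := by rw [h]; rfl
  exact this.1

theorem IsBase.not_par (hK : K ∈ L.Circles) (hpK : p ∈ K) {M : Set P} {b : P}
    (h : L.IsBase p K M b) (hpM : p ∉ M) : ¬ L.Par p b := by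
  obtain ⟨C, hC, h⟩ := h
  have hb : b ∈ M ∩ C := by rw [h]; rfl
  intro hpb
  exact hpM ((eq_of_par (circle_of_mem_pencil hK hC) (mem_of_mem_pencil hpK hC) hb.2 hpb) ▸ hb.1)

theorem IsBase.unique (hA3 : ∀ M ∈ L.Circles, p ∉ M → ∃! N, N ∈ L.pencil p K ∧ ∃ z, M ∩ N = {z})
    {M : Set P} (hM : M ∈ L.Circles) (hpM : p ∉ M) {a b : P}
    (ha : L.IsBase p K M a) (hb : L.IsBase p K M b) : a = b := by
  obtain ⟨C, hC, ha⟩ := ha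
  obtain ⟨D, hD, hb⟩ := hb
  obtain rfl := (hA3 M hM hpM).unique ⟨hC, a, ha⟩ ⟨hD, b, hb⟩
  exact Set.singleton_injective (ha.symm.trans hb)

/-- A circle missing `p` is determined by its base point and its point parallel to `p`. -/
theorem IsBase.circle_eq (hK : K ∈ L.Circles) (hpK : p ∈ K) {M N : Set P}
    (hM : M ∈ L.Circles) (hN : N ∈ L.Circles) (hpM : p ∉ M) {b m : P}
    (hbM : L.IsBase p K M b) (hbN : L.IsBase p K N b)
    (hpm : L.Par p m) (hmM : m ∈ M) (hmN : m ∈ N) : M = N := by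
  have hpb := hbM.not_par hK hpK hpM
  obtain ⟨C, hC, hMC⟩ := hbM
  obtain ⟨D, hD, hND⟩ := hbN
  have hb : b ∈ M ∩ C := by rw [hMC]; rfl
  have hb' : b ∈ N ∩ D := by rw [hND]; rfl
  obtain rfl := pencil_eq_of_mem hK hpK hC hD hpb hb.2 hb'.2
  have hCc := circle_of_mem_pencil hK hC
  have hmC : m ∉ C := fun h =>
    hpM ((eq_of_par hCc (mem_of_mem_pencil hpK hC) h hpm) ▸ hmM)
  exact (L.touching C hCc b hb.2 m hmC
    fun h => hpb (L.par_equiv.trans hpm (L.par_equiv.symm h))).unique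
    ⟨hM, hmM, by rw [Set.inter_comm, hMC]⟩ ⟨hN, hmN, by rw [Set.inter_comm, hND]⟩

/-- Any two affine points on different generators are joined by a circle tangent to the pencil
at the first, unless they lie on a common circle of the pencil. -/
theorem exists_isBase (hK : K ∈ L.Circles) (hpK : p ∈ K) {x y : P} (hx : ¬ L.Par p x)
    (hxy : ¬ L.Par x y) {C : Set P} (hC : C ∈ L.pencil p K) (hxC : x ∈ C) (hyC : y ∉ C) :
    ∃ M ∈ L.Circles, y ∈ M ∧ p ∉ M ∧ L.IsBase p K M x := by
  obtain ⟨M, ⟨hM, hyM, hCM⟩, -⟩ := L.touching C (circle_of_mem_pencil hK hC) x hxC y hyC hxy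
  refine ⟨M, hM, hyM, fun hpM => ?_, C, hC, by rw [Set.inter_comm, hCM]⟩
  have : p ∈ C ∩ M := ⟨mem_of_mem_pencil hpK hC, hpM⟩
  rw [hCM] at this
  exact hx (this ▸ L.par_equiv.refl x)

/-- The hypotheses on the group Δ, including (A1) and (A2). -/
structure IsResidualGroup (L : LaguerrePlane P) (p : P) (K : Set P)
    (Δ : Subgroup (Equiv.Perm P)) : Prop where
  aut : ∀ σ ∈ Δ, L.IsAut σ
  fix : ∀ σ ∈ Δ, ∀ q, L.Par p q → σ q = q
  pen : ∀ σ ∈ Δ, ∀ M ∈ L.pencil p K, ⇑σ '' M ∈ L.pencil p K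
  trans : ∀ x y : P, ¬ L.Par p x → ¬ L.Par p y → ∃ σ ∈ Δ, σ x = y
  stab : ∀ r ∈ K, r ≠ p → ∀ x ∈ K, x ≠ p → x ≠ r → ∀ y ∈ K, y ≠ p → y ≠ r →
    ∃ σ ∈ Δ, σ r = r ∧ σ x = y

namespace IsResidualGroup

theorem par_iff (h : IsResidualGroup L p K Δ) {σ : Equiv.Perm P} (hσ : σ ∈ Δ) (x : P) :
    L.Par p (σ x) ↔ L.Par p x := by
  have := (h.aut σ hσ).2 p x
  rw [h.fix σ hσ p (L.par_equiv.refl p)] at this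
  exact this.symm

theorem image_circle (h : IsResidualGroup L p K Δ) {σ : Equiv.Perm P} (hσ : σ ∈ Δ) {M : Set P}
    (hM : M ∈ L.Circles) : σ '' M ∈ L.Circles :=
  ((h.aut σ hσ).1 M).1 hM

theorem mem_image (h : IsResidualGroup L p K Δ) {σ : Equiv.Perm P} (hσ : σ ∈ Δ) {M : Set P}
    {m : P} (hm : L.Par p m) : m ∈ σ '' M ↔ m ∈ M := by
  conv_lhs => rw [← h.fix σ hσ m hm]
  exact σ.injective.mem_set_image

theorem isBase_image (h : IsResidualGroup L p K Δ) {σ : Equiv.Perm P} (hσ : σ ∈ Δ) {M : Set P}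
    {b : P} (hb : L.IsBase p K M b) : L.IsBase p K (σ '' M) (σ b) := by
  obtain ⟨C, hC, hMC⟩ := hb
  exact ⟨σ '' C, h.pen σ hσ C hC, by rw [← Set.image_inter σ.injective, hMC, Set.image_singleton]⟩

theorem image_eq (h : IsResidualGroup L p K Δ) (hK : K ∈ L.Circles) (hpK : p ∈ K)
    {M N : Set P} (hM : M ∈ L.Circles) (hN : N ∈ L.Circles) (hpM : p ∉ M)
    {b m : P} (hbM : L.IsBase p K M b) (hpm : L.Par p m) (hmM : m ∈ M) (hmN : m ∈ N)
    {σ : Equiv.Perm P} (hσ : σ ∈ Δ) (hbN : L.IsBase p K N (σ b)) : σ '' M = N :=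
  IsBase.circle_eq hK hpK (h.image_circle hσ hM) hN
    (mt (h.mem_image hσ (L.par_equiv.refl p)).1 hpM) (h.isBase_image hσ hbM) hbN hpm
    ((h.mem_image hσ hpm).2 hmM) hmN

/-- The stabilizer of an affine point is transitive on the remaining affine generators. -/
theorem exists_stab_par (h : IsResidualGroup L p K Δ) (hK : K ∈ L.Circles) (hpK : p ∈ K)
    {z x y : P} (hz : ¬ L.Par p z) (hx : ¬ L.Par p x) (hy : ¬ L.Par p y)
    (hzx : ¬ L.Par z x) (hzy : ¬ L.Par z y) : ∃ τ ∈ Δ, τ z = z ∧ L.Par (τ x) y := by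
  have symm := fun {a b} => L.par_equiv.symm (x := a) (y := b)
  have tr := fun {a b c} => L.par_equiv.trans (x := a) (y := b) (z := c)
  obtain ⟨r, ⟨hzr, hrK⟩, -⟩ := L.parPoint z K hK
  have hr : ¬ L.Par p r := fun hpr => hz (tr hpr (symm hzr))
  obtain ⟨ρ, hρ, rfl⟩ := h.trans z r hz hr
  have key : ∀ w, ¬ L.Par p w → ¬ L.Par z w → ∃ k ∈ K, k ≠ p ∧ k ≠ ρ z ∧ L.Par (ρ w) k := by
    intro w hw hzw
    obtain ⟨k, ⟨hwk, hkK⟩, -⟩ := L.parPoint (ρ w) K hK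
    refine ⟨k, hkK, ?_, ?_, hwk⟩
    · rintro rfl
      exact hw ((h.par_iff hρ w).1 (symm hwk))
    · rintro rfl
      exact hzw (((h.aut ρ hρ).2 z w).2 (symm hwk))
  obtain ⟨k, hkK, hkp, hkr, hk⟩ := key x hx hzx
  obtain ⟨l, hlK, hlp, hlr, hl⟩ := key y hy hzy
  obtain ⟨σ, hσ, hσr, rfl⟩ := h.stab (ρ z) hrK (fun e => hr (e ▸ L.par_equiv.refl _))
    k hkK hkp hkr l hlK hlp hlr
  refine ⟨ρ⁻¹ * σ * ρ, Δ.mul_mem (Δ.mul_mem (Δ.inv_mem hρ) hσ) hρ, ?_, ?_⟩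
  · simp [Equiv.Perm.mul_apply, hσr]
  · rw [(h.aut ρ hρ).2]
    have hρσ : ρ ((ρ⁻¹ * σ * ρ) x) = σ (ρ x) := by simp [Equiv.Perm.mul_apply]
    rw [hρσ]
    exact tr (((h.aut σ hσ).2 _ _).1 hk) (symm hl)

/-- Circles through a common point parallel to `p` whose base points are distinct and parallel
do not meet outside the generator of `p`. -/
theorem par_of_mem_of_mem (h : IsResidualGroup L p K Δ) (hK : K ∈ L.Circles) (hpK : p ∈ K)
    {M N : Set P} (hM : M ∈ L.Circles) (hN : N ∈ L.Circles) (hpM : p ∉ M) (hpN : p ∉ N)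
    {a b m w : P} (ha : L.IsBase p K M a) (hb : L.IsBase p K N b) (hab : a ≠ b)
    (hpar : L.Par a b) (hpm : L.Par p m) (hmM : m ∈ M) (hmN : m ∈ N) (hwM : w ∈ M)
    (hwN : w ∈ N) : L.Par p w := by
  by_contra hw
  have hpa := ha.not_par hK hpK hpM
  have hpb := hb.not_par hK hpK hpN
  have symm := fun {a b} => L.par_equiv.symm (x := a) (y := b)
  have tr := fun {a b c} => L.par_equiv.trans (x := a) (y := b) (z := c)
  have haw : ¬ L.Par a w := fun haw => hab <|
    (eq_of_par hM ha.mem hwM haw).trans (eq_of_par hN hb.mem hwN (tr (symm hpar) haw)).symm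
  have hbw : ¬ L.Par b w := fun hbw => haw (tr hpar hbw)
  -- an element of `Δ` moving `(a, w)` to `(b, w)`
  obtain ⟨σ, hσ, hσa, hσw⟩ : ∃ σ ∈ Δ, σ a = b ∧ σ w = w := by
    obtain ⟨ρ, hρ, hρa⟩ := h.trans a b hpa hpb
    obtain ⟨τ, hτ, hτb, hτw⟩ := h.exists_stab_par hK hpK hpb
      (mt (h.par_iff hρ w).1 hw) hw (fun hb' => haw (((h.aut ρ hρ).2 a w).2 (hρa ▸ hb'))) hbw
    have hτρ : (τ * ρ) a = b := by simp [Equiv.Perm.mul_apply, hρa, hτb]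
    refine ⟨τ * ρ, Δ.mul_mem hτ hρ, hτρ, ?_⟩
    have himg := h.image_eq hK hpK hM hN hpM ha hpm hmM hmN (Δ.mul_mem hτ hρ) (hτρ.symm ▸ hb)
    exact eq_of_par hN (himg ▸ Set.mem_image_of_mem _ hwM) hwN hτw
  obtain ⟨C, hC, hwC⟩ := exists_mem_pencil hK hpK hw
  have haC : a ∉ C := by
    intro haC
    obtain ⟨D, hD, hMD⟩ := ha
    have haD : a ∈ M ∩ D := by rw [hMD]; rfl
    obtain rfl := pencil_eq_of_mem hK hpK hC hD hpa haC haD.2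
    have : w ∈ M ∩ C := ⟨hwM, hwC⟩
    rw [hMD] at this
    exact haw (this ▸ L.par_equiv.refl w)
  obtain ⟨Q, hQ, haQ, hpQ, hwQ⟩ := exists_isBase hK hpK hw (fun e => haw (symm e)) hC hwC haC
  obtain ⟨q, ⟨hpq, hqQ⟩, -⟩ := L.parPoint p Q hQ
  have hσQ := h.image_eq hK hpK hQ hQ hpQ hwQ hpq hqQ hqQ hσ (hσw.symm ▸ hwQ)
  have hbQ : b ∈ Q := hσQ ▸ hσa ▸ Set.mem_image_of_mem _ haQ
  exact hab (eq_of_par hQ haQ hbQ hpar)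

end IsResidualGroup

theorem exists_mem_not_par {M : Set P} (hM : M ∈ L.Circles) (x y : P) :
    ∃ v ∈ M, ¬ L.Par x v ∧ ¬ L.Par y v := by
  have symm := fun {a b} => L.par_equiv.symm (x := a) (y := b)
  have tr := fun {a b c} => L.par_equiv.trans (x := a) (y := b) (z := c)
  obtain ⟨C, hC, ⟨a, b, c, ha, hb, hc, hab, hbc, hac⟩, -⟩ := L.nontriv
  obtain ⟨u, hu⟩ : ∃ u, ¬ L.Par x u ∧ ¬ L.Par y u := by
    by_contra! hall
    have h1 := fun e => hab (eq_of_par hC ha hb e)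
    have h2 := fun e => hbc (eq_of_par hC hb hc e)
    have h3 := fun e => hac (eq_of_par hC ha hc e)
    by_cases hxa : L.Par x a
    · exact h2 (tr (symm (hall b fun e => h1 (tr (symm hxa) e)))
        (hall c fun e => h3 (tr (symm hxa) e)))
    · have hya := hall a hxa
      have hxb : L.Par x b := by
        by_contra e
        exact h1 (tr (symm hya) (hall b e))
      have hxc : L.Par x c := by
        by_contra e
        exact h3 (tr (symm hya) (hall c e))
      exact h2 (tr (symm hxb) hxc)
  obtain ⟨v, ⟨huv, hv⟩, -⟩ := L.parPoint u M hM
  exact ⟨v, hv, fun e => hu.1 (tr e (symm huv)), fun e => hu.2 (tr e (symm huv))⟩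

/-- Under (A3), a circle missing `p` is determined by its points outside the generator of `p`. -/
theorem eq_of_diff_gen_eq (hK : K ∈ L.Circles) (hpK : p ∈ K)
    (hA3 : ∀ M ∈ L.Circles, p ∉ M → ∃! N, N ∈ L.pencil p K ∧ ∃ z, M ∩ N = {z})
    {M N : Set P} (hM : M ∈ L.Circles) (hN : N ∈ L.Circles) (hpM : p ∉ M)
    (hMN : M \ L.gen p = N \ L.gen p) : M = N := by
  have hmem : ∀ x ∈ M, ¬ L.Par p x → x ∈ N := fun x hx hpx =>
    (hMN ▸ (⟨hx, hpx⟩ : x ∈ M \ L.gen p) : x ∈ N \ L.gen p).1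
  obtain ⟨C, ⟨hC, z, hz⟩, -⟩ := id (hA3 M hM hpM)
  have hbase : L.IsBase p K M z := ⟨C, hC, hz⟩
  have hpz := hbase.not_par hK hpK hpM
  have hzC : z ∈ M ∩ C := by rw [hz]; rfl
  obtain ⟨v, hvM, hpv, hzv⟩ := exists_mem_not_par hM p z
  obtain ⟨D, hD, hvD⟩ := exists_mem_pencil hK hpK hpv
  have hne : C ≠ D := by
    rintro rfl
    have : v ∈ M ∩ C := ⟨hvM, hvD⟩
    rw [hz] at this
    exact hzv (this ▸ L.par_equiv.refl v)
  have hzD : z ∉ D := fun hzD => hne (pencil_eq_of_mem hK hpK hC hD hpz hzC.2 hzD)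
  obtain ⟨u, ⟨huM, huD⟩, huv⟩ : ∃ u ∈ M ∩ D, u ≠ v := by
    by_contra! hall
    exact hne ((hA3 M hM hpM).unique ⟨hC, z, hz⟩
      ⟨hD, v, Set.eq_singleton_iff_unique_mem.2 ⟨⟨hvM, hvD⟩, hall⟩⟩)
  have hpu : ¬ L.Par p u := fun e =>
    hpM ((eq_of_par (circle_of_mem_pencil hK hD) (mem_of_mem_pencil hpK hD) huD e) ▸ huM)
  have hvu : ¬ L.Par v u := fun e => huv (eq_of_par hM hvM huM e).symm
  have hzu : ¬ L.Par z u := fun e => hzD ((eq_of_par hM hzC.1 huM e) ▸ huD)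
  exact (L.joinCircle z v u hzv hvu hzu).unique ⟨hM, hzC.1, hvM, huM⟩
    ⟨hN, hmem z hzC.1 hpz, hmem v hvM hpv, hmem u huM hpu⟩

/-- Circles through a common point parallel to `p` that do not meet outside the generator of `p`
have parallel base points. -/
theorem IsResidualGroup.par_of_disjoint (h : IsResidualGroup L p K Δ) (hK : K ∈ L.Circles)
    (hpK : p ∈ K)
    (hA3 : ∀ M ∈ L.Circles, p ∉ M → ∃! N, N ∈ L.pencil p K ∧ ∃ z, M ∩ N = {z})
    {M N : Set P} (hM : M ∈ L.Circles) (hN : N ∈ L.Circles) (hpM : p ∉ M) (hpN : p ∉ N)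
    {a b m : P} (ha : L.IsBase p K M a) (hb : L.IsBase p K N b) (hpm : L.Par p m)
    (hmM : m ∈ M) (hmN : m ∈ N) (hdisj : ∀ w ∈ M, w ∈ N → L.Par p w) : L.Par a b := by
  by_contra hab
  have hpa := ha.not_par hK hpK hpM
  have hpb := hb.not_par hK hpK hpN
  have symm := fun {a b} => L.par_equiv.symm (x := a) (y := b)
  have tr := fun {a b c} => L.par_equiv.trans (x := a) (y := b) (z := c)
  obtain ⟨u, huM, hpu, hau⟩ := exists_mem_not_par hM p a
  obtain ⟨ρ, hρ, hρu⟩ := h.trans u b hpu hpb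
  obtain ⟨τ, hτ, hτb, hτa⟩ := h.exists_stab_par hK hpK hpb
    (mt (h.par_iff hρ a).1 hpa) hpa
    (fun e => hau (symm (((h.aut ρ hρ).2 u a).2 (hρu.symm ▸ e)))) (fun e => hab (symm e))
  have hσ := Δ.mul_mem hτ hρ
  -- `Q` is the circle through `b` and `m` with base point on the generator of `a`
  set Q := (τ * ρ) '' M with hQdef
  have hQ : Q ∈ L.Circles := h.image_circle hσ hM
  have hpQ : p ∉ Q := mt (h.mem_image hσ (L.par_equiv.refl p)).1 hpM
  have hmQ : m ∈ Q := (h.mem_image hσ hpm).2 hmM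
  have hc : L.IsBase p K Q ((τ * ρ) a) := h.isBase_image hσ ha
  have hbQ : b ∈ Q := ⟨u, huM, by simp [Equiv.Perm.mul_apply, hρu, hτb]⟩
  have hca : L.Par ((τ * ρ) a) a := hτa
  have hbM : b ∉ M := fun e => hpb (hdisj b e hb.mem)
  have hne : a ≠ (τ * ρ) a := fun e => hbM <|
    (IsBase.circle_eq hK hpK hM hQ hpM ha (e ▸ hc) hpm hmM hmQ) ▸ hbQ
  have htan : ∀ {R : Set P}, m ∈ R → (∀ w ∈ M, w ∈ R → L.Par p w) → M ∩ R = {m} := by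
    intro R hmR hR
    refine Set.eq_singleton_iff_unique_mem.2 ⟨⟨hmM, hmR⟩, fun w hw => ?_⟩
    exact (eq_of_par hM hmM hw.1 (tr (symm hpm) (hR w hw.1 hw.2))).symm
  have hQN : Q = N := (L.touching M hM m hmM b hbM fun e => hpb (tr hpm e)).unique
    ⟨hQ, hbQ, htan hmQ fun w hwM hwQ => h.par_of_mem_of_mem hK hpK hM hQ hpM hpQ ha hc hne
      (symm hca) hpm hmM hmQ hwM hwQ⟩
    ⟨hN, hb.mem, htan hmN hdisj⟩
  exact hab (IsBase.unique hA3 hN hpN (hQN ▸ hc) hb ▸ symm hca)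

end LaguerrePlane

/-- assume (A3).  Proper parallel lines M ∖ p̄, N ∖ p̄ of SA(p,K)
determined by circles are disjoint iff the base points of M, N are distinct and
parallel. -/
theorem proper_parallel_disjoint_iff
    {P : Type*} (L : LaguerrePlane P) (p : P) (K : Set P)
    (Δ : Subgroup (Equiv.Perm P))
    (hK : K ∈ L.Circles) (hpK : p ∈ K)
    (haut : ∀ σ ∈ Δ, L.IsAut σ)
    (hfix : ∀ σ ∈ Δ, ∀ q, L.Par p q → σ q = q)
    (hpen : ∀ σ ∈ Δ, ∀ M ∈ L.pencil p K, ⇑σ '' M ∈ L.pencil p K)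
    (hA1 : ∀ x y : P, ¬ L.Par p x → ¬ L.Par p y → ∃ σ ∈ Δ, σ x = y)
    (hA2 : ∀ r ∈ K, r ≠ p → ∀ x ∈ K, x ≠ p → x ≠ r → ∀ y ∈ K, y ≠ p → y ≠ r →
      ∃ σ ∈ Δ, σ r = r ∧ σ x = y)    (hA3 : ∀ M ∈ L.Circles, p ∉ M → ∃! N, N ∈ L.pencil p K ∧ ∃ z, M ∩ N = {z})    :
    ∀ M ∈ L.Circles, ∀ N ∈ L.Circles, p ∉ M → p ∉ N →
    LinePar Δ (M \ L.gen p) (N \ L.gen p) →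
    ¬ (∀ z ∈ M \ L.gen p, ∀ w ∈ M \ L.gen p, z ≠ w →
        line Δ z w = M \ L.gen p) →
    ¬ (∀ z ∈ N \ L.gen p, ∀ w ∈ N \ L.gen p, z ≠ w →
        line Δ z w = N \ L.gen p) →
    ((M \ L.gen p) ∩ (N \ L.gen p) = ∅ ↔
      ∃ bm bn : P, (∃ C ∈ L.pencil p K, M ∩ C = {bm}) ∧
        (∃ C ∈ L.pencil p K, N ∩ C = {bn}) ∧ bm ≠ bn ∧ L.Par bm bn) := by
  intro M hM N hN hpM hpN hpar _ _
  have h : IsResidualGroup L p K Δ := ⟨haut, hfix, hpen, hA1, hA2⟩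
  obtain ⟨σ, hσ, hσMN⟩ := hpar
  have hgen : σ '' L.gen p = L.gen p := by
    ext x
    constructor
    · rintro ⟨y, hy, rfl⟩
      exact (h.par_iff hσ y).2 hy
    · exact fun hx => ⟨x, hx, h.fix σ hσ x hx⟩
  rw [Set.image_sdiff σ.injective, hgen] at hσMN
  have hN' : σ '' M = N := eq_of_diff_gen_eq hK hpK hA3 (h.image_circle hσ hM) hN
    (mt (h.mem_image hσ (L.par_equiv.refl p)).1 hpM) hσMN
  obtain ⟨m, ⟨hpm, hmM⟩, -⟩ := L.parPoint p M hM
  have hmN : m ∈ N := hN' ▸ (h.mem_image hσ hpm).2 hmM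
  constructor
  · intro hdisj
    have hd : ∀ w ∈ M, w ∈ N → L.Par p w := by
      intro w hwM hwN
      by_contra hw
      exact Set.eq_empty_iff_forall_notMem.1 hdisj w ⟨⟨hwM, hw⟩, hwN, hw⟩
    obtain ⟨C, ⟨hC, a, ha⟩, -⟩ := hA3 M hM hpM
    obtain ⟨D, ⟨hD, b, hb⟩, -⟩ := hA3 N hN hpN
    have ha' : L.IsBase p K M a := ⟨C, hC, ha⟩
    have hb' : L.IsBase p K N b := ⟨D, hD, hb⟩
    refine ⟨a, b, ha', hb', ?_, h.par_of_disjoint hK hpK hA3 hM hN hpM hpN ha' hb' hpm hmM hmN hd⟩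
    rintro rfl
    exact ha'.not_par hK hpK hpM (hd a ha'.mem hb'.mem)
  · rintro ⟨a, b, ha, hb, hab, hpar⟩
    refine Set.eq_empty_iff_forall_notMem.2 ?_
    rintro w ⟨⟨hwM, hw⟩, hwN, -⟩
    exact hw (h.par_of_mem_of_mem hK hpK hM hN hpM hpN ha hb hab hpar hpm hmM hmN hwM hwN)
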